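/- If the 3-CNF formula φ is not satisfied by any Boolean assignment a ∈ {0,1}^p, then f_φ(x) = 0 for every x ∈ ℝ^p. -/

import Mathlib

open MeasureTheory

noncomputable def f0 (ε x : ℝ) : ℝ :=
  ε⁻¹ * (max 0 (x + ε) - 2 * max 0 x + max 0 (x - ε))

noncomputable def f1 (ε x : ℝ) : ℝ := f0 ε (x - 1)

/-- A literal over `p` Boolean variables: a variable index and a polarity. -/
structure Lit (p : ℕ) where
  idx : Fin p
  pos : Bool

/-- Value of a literal on a real input: `f1` for a positive literal, `f0` for a negated one. -/
noncomputable def litVal (ε : ℝ) {p : ℕ} (L : Lit p) (x : Fin p → ℝ) : ℝ :=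
  if L.pos then f1 ε (x L.idx) else f0 ε (x L.idx)

/-- Clause function `g_j(x) = Σ_{k=1}^{3} f0(ℓ₁(x) + ℓ₂(x) + ℓ₃(x) − k)`. -/
noncomputable def clauseVal (ε : ℝ) {p : ℕ} (C : Fin 3 → Lit p) (x : Fin p → ℝ) : ℝ :=
  ∑ k ∈ Finset.Icc (1 : ℕ) 3, f0 ε ((∑ t, litVal ε (C t) x) - (k : ℝ))

/-- Formula function `f_φ(x) = f0(Σ_{j=1}^{c} g_j(x) − c)`. -/
noncomputable def cnfVal (ε : ℝ) {p c : ℕ} (φ : Fin c → Fin 3 → Lit p) (x : Fin p → ℝ) : ℝ :=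
  f0 ε ((∑ j, clauseVal ε (φ j) x) - (c : ℝ))

/-- A Boolean assignment satisfies `φ` if every clause has a true literal. -/
def Satisfies {p c : ℕ} (a : Fin p → Bool) (φ : Fin c → Fin 3 → Lit p) : Prop :=
  ∀ j, ∃ t, a (φ j t).idx = (φ j t).pos

/-- Real embedding of a Boolean assignment. -/
noncomputable def embed {p : ℕ} (a : Fin p → Bool) : Fin p → ℝ :=
  fun i => if a i then 1 else 0

theorem f0_eq_zero {ε x : ℝ} (hε : 0 < ε) (hx : ε ≤ |x|) : f0 ε x = 0 := by
  unfold f0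
  rcases le_abs.1 hx with h | h
  · rw [max_eq_right (by linarith), max_eq_right (by linarith), max_eq_right (by linarith)]
    ring
  · rw [max_eq_left (by linarith), max_eq_left (by linarith), max_eq_left (by linarith)]
    ring

theorem abs_lt_of_f0_ne_zero {ε x : ℝ} (hε : 0 < ε) (hx : f0 ε x ≠ 0) : |x| < ε := by
  by_contra! h
  exact hx (f0_eq_zero hε h)

theorem f0_le_one {ε : ℝ} (hε : 0 < ε) (x : ℝ) : f0 ε x ≤ 1 := by
  unfold f0
  rw [inv_mul_le_iff₀ hε]
  rcases max_cases 0 (x + ε) with h₁ | h₁ <;> rcases max_cases 0 x with h₂ | h₂ <;>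
    rcases max_cases 0 (x - ε) with h₃ | h₃ <;> linarith

theorem sum_f0_sub_natCast_le_one {ε : ℝ} (hε : 0 < ε) (hε' : ε < 1 / 2) (s : Finset ℕ) (y : ℝ) :
    ∑ k ∈ s, f0 ε (y - (k : ℝ)) ≤ 1 := by
  by_cases h : ∃ k ∈ s, f0 ε (y - (k : ℝ)) ≠ 0
  · obtain ⟨k, hk, hne⟩ := h
    rw [Finset.sum_eq_single_of_mem k hk]
    · exact f0_le_one hε _
    · intro l _ hlk
      by_contra hl
      have hk' := abs_lt.1 (abs_lt_of_f0_ne_zero hε hne)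
      have hl' := abs_lt.1 (abs_lt_of_f0_ne_zero hε hl)
      rcases lt_or_gt_of_ne hlk with hlt | hlt
      · have : (l : ℝ) + 1 ≤ k := by exact_mod_cast hlt
        linarith
      · have : (k : ℝ) + 1 ≤ l := by exact_mod_cast hlt
        linarith
  · push Not at h
    rw [Finset.sum_eq_zero h]
    exact zero_le_one

theorem exists_litVal_pos_of_clauseVal_ne_zero {ε : ℝ} (hε : 0 < ε) (hε' : ε < 1 / 2) {p : ℕ}
    {C : Fin 3 → Lit p} {x : Fin p → ℝ} (h : clauseVal ε C x ≠ 0) :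
    ∃ t, 0 < litVal ε (C t) x := by
  obtain ⟨k, hk, hne⟩ := Finset.exists_ne_zero_of_sum_ne_zero h
  have hk₁ : (1 : ℝ) ≤ k := by exact_mod_cast (Finset.mem_Icc.1 hk).1
  have hlt := abs_lt.1 (abs_lt_of_f0_ne_zero hε hne)
  by_contra! hle
  have := Finset.sum_nonpos fun t (_ : t ∈ Finset.univ) => hle t
  linarith

theorem decide_abs_sub_one_lt_eq_of_litVal_pos {ε : ℝ} (hε : 0 < ε) (hε' : ε < 1 / 2) {p : ℕ}
    {L : Lit p} {x : Fin p → ℝ} (h : 0 < litVal ε L x) :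
    decide (|x L.idx - 1| < ε) = L.pos := by
  unfold litVal f1 at h
  cases hL : L.pos
  · simp only [hL, Bool.false_eq_true, if_false] at h
    have h₀ := abs_lt.1 (abs_lt_of_f0_ne_zero hε h.ne')
    rw [decide_eq_false_iff_not]
    intro h₁
    have := abs_lt.1 h₁
    linarith
  · simp only [hL, if_true] at h
    exact decide_eq_true (abs_lt_of_f0_ne_zero hε h.ne')

theorem stmt8 (ε : ℝ) (hε : 0 < ε) (hε' : ε < 1 / 2)
    (p c : ℕ) (φ : Fin c → Fin 3 → Lit p)
    (h : ¬ ∃ a : Fin p → Bool, Satisfies a φ) :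
    ∀ x : Fin p → ℝ, cnfVal ε φ x = 0 := by
  intro x
  by_contra hx
  refine h ⟨fun i => decide (|x i - 1| < ε), fun j => ?_⟩
  have hlt := abs_lt.1 (abs_lt_of_f0_ne_zero hε hx)
  have hj : clauseVal ε (φ j) x ≠ 0 := by
    intro hj
    have hsum : ∑ i, (1 - clauseVal ε (φ i) x) = c - ∑ i, clauseVal ε (φ i) x := by
      simp
    have hle := Finset.single_le_sum (f := fun i => 1 - clauseVal ε (φ i) x)
      (fun i _ => sub_nonneg.2 (sum_f0_sub_natCast_le_one hε hε' _ _)) (Finset.mem_univ j)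
    simp only [hj, hsum] at hle
    linarith
  obtain ⟨t, ht⟩ := exists_litVal_pos_of_clauseVal_ne_zero hε hε' hj
  exact ⟨t, decide_abs_sub_one_lt_eq_of_litVal_pos hε hε' ht⟩
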